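/- arXiv:1912.08327 — 2 statements merged into one kernel-verified Lean document; each statement's English description precedes it below -/
import Mathlib

section
/- Let G be a finite tree on at least 2 vertices, let λ₂(G) be the second-smallest eigenvalue of its Laplacian matrix L = D − A, and let φ be an eigenvector of L with eigenvalue λ₂(G). Let p₀, p₁, …, p_m (m ≥ 2) be a path in G (consecutive vertices adjacent) such that φ(p₀) < 0 and φ(p_i) > 0 for all 1 ≤ i ≤ m. Then φ is strictly increasing along the path: φ(p₁) < φ(p₂) < … < φ(p_m). -/
open Matrix

/-- `(l, φ)` is an eigenpair of the (combinatorial) graph Laplacian `L = D - A`. -/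
def SimpleGraph.IsLapEigenpair {V : Type*} [Fintype V] [DecidableEq V]
    (G : SimpleGraph V) [DecidableRel G.Adj] (l : ℝ) (φ : V → ℝ) : Prop :=
  φ ≠ 0 ∧ G.lapMatrix ℝ *ᵥ φ = l • φ

/-- `l` is the second-smallest eigenvalue `λ₂(G)` of the Laplacian of a connected graph,
i.e. its smallest positive eigenvalue. -/
def SimpleGraph.IsSecondLapEigenvalue {V : Type*} [Fintype V] [DecidableEq V]
    (G : SimpleGraph V) [DecidableRel G.Adj] (l : ℝ) : Prop :=
  (∃ φ, G.IsLapEigenpair l φ) ∧ 0 < l ∧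
    ∀ μ : ℝ, 0 < μ → (∃ ψ, G.IsLapEigenpair μ ψ) → l ≤ μ

lemma aux_lap_apply {V : Type*} [Fintype V] [DecidableEq V]
    (G : SimpleGraph V) [DecidableRel G.Adj] (x : V → ℝ) (u : V) :
    (G.lapMatrix ℝ *ᵥ x) u = ∑ w ∈ G.neighborFinset u, (x u - x w) := by
  rw [SimpleGraph.lapMatrix_mulVec_apply, Finset.sum_sub_distrib, Finset.sum_const,
    SimpleGraph.card_neighborFinset_eq_degree, nsmul_eq_mul]

lemma aux_symm {V : Type*} [Fintype V] [DecidableEq V]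
    (G : SimpleGraph V) [DecidableRel G.Adj] (x y : V → ℝ) :
    x ⬝ᵥ (G.lapMatrix ℝ *ᵥ y) = (G.lapMatrix ℝ *ᵥ x) ⬝ᵥ y := by
  rw [Matrix.dotProduct_mulVec, ← Matrix.mulVec_transpose, (G.isSymm_lapMatrix (R := ℝ))]

lemma aux_rayleigh {V : Type*} [Fintype V] [DecidableEq V]
    (G : SimpleGraph V) [DecidableRel G.Adj] (hG : G.Connected)
    (l : ℝ) (hl : G.IsSecondLapEigenvalue l) (x : V → ℝ) (hx : ∑ u, x u = 0) :
    l * ∑ u, x u ^ 2 ≤ ∑ u, x u * (G.lapMatrix ℝ *ᵥ x) u := by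
  have hH : (G.lapMatrix ℝ).IsHermitian := (G.posSemidef_lapMatrix ℝ).1
  set b := hH.eigenvectorBasis with hb
  have key : ∀ y z : V → ℝ, ∑ u, y u * z u = ∑ i, (y ⬝ᵥ ⇑(b i)) * (⇑(b i) ⬝ᵥ z) := by
    intro y z
    have h := b.sum_inner_mul_inner (WithLp.toLp 2 y) (WithLp.toLp 2 z)
    simp only [PiLp.inner_apply, RCLike.inner_apply, conj_trivial] at h
    simp only [dotProduct]
    rw [Finset.sum_congr rfl (fun u _ => mul_comm (y u) (z u)), ← h]
    refine Finset.sum_congr rfl fun i _ => ?_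
    congr 1
    · exact Finset.sum_congr rfl fun u _ => mul_comm _ _
    · exact Finset.sum_congr rfl fun u _ => mul_comm _ _
  have h1 := key x x
  have h2 := key x (G.lapMatrix ℝ *ᵥ x)
  simp only [sq]
  rw [h1, h2, Finset.mul_sum]
  refine Finset.sum_le_sum fun i _ => ?_
  have hei : G.lapMatrix ℝ *ᵥ ⇑(b i) = hH.eigenvalues i • ⇑(b i) := hH.mulVec_eigenvectorBasis i
  rw [aux_symm, hei, smul_dotProduct, dotProduct_comm x, smul_eq_mul]
  have hne : (⇑(b i) : V → ℝ) ≠ 0 := by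
    intro h0
    apply b.toBasis.ne_zero i
    rw [b.coe_toBasis]
    ext u
    exact congrFun h0 u
  have hnn : 0 ≤ hH.eigenvalues i := (G.posSemidef_lapMatrix ℝ).eigenvalues_nonneg i
  rcases hnn.eq_or_lt with h0 | hpos
  · rw [← h0, zero_smul, SimpleGraph.lapMatrix_mulVec_eq_zero_iff_forall_reachable] at hei
    have : ⇑(b i) ⬝ᵥ x = 0 := by
      obtain ⟨v⟩ := hG.nonempty
      have : ∀ u, b i u = b i v := fun u => hei u v (hG.preconnected u v)
      simp only [dotProduct, this, ← Finset.mul_sum, hx, mul_zero]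
    simp [this]
  · have := hl.2.2 _ hpos ⟨_, hne, hei⟩
    nlinarith [mul_self_nonneg (⇑(b i) ⬝ᵥ x)]

lemma aux_nonneg {V : Type*} [Fintype V] [DecidableEq V]
    (G : SimpleGraph V) [DecidableRel G.Adj] (hG : G.Connected)
    (l : ℝ) (hl : G.IsSecondLapEigenvalue l) (φ : V → ℝ)
    (hφ : G.lapMatrix ℝ *ᵥ φ = l • φ) (B : Finset V)
    (hcross : ∀ u w, G.Adj u w → u ∈ B → w ∉ B → 0 < φ u ∧ 0 < φ w)
    (p q : V) (hp : p ∉ B) (hpq : G.Adj p q) (hp0 : φ p < 0) (hq0 : 0 < φ q) :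
    ∀ v ∈ B, 0 ≤ φ v := by
  by_contra! hcon
  obtain ⟨v, hv, hv0⟩ := hcon
  set f : V → ℝ := fun u => if u ∈ B then 0 else max (-φ u) 0 with hf
  set g : V → ℝ := fun u => if u ∈ B then max (-φ u) 0 else 0 with hg
  have hf0 : ∀ u, 0 ≤ f u := by intro u; simp only [hf]; split_ifs <;> simp
  have hg0 : ∀ u, 0 ≤ g u := by intro u; simp only [hg]; split_ifs <;> simp
  set s := ∑ u, g u with hs
  set t := ∑ u, f u with ht
  have hspos : 0 < s := Finset.sum_pos' (fun u _ => hg0 u) ⟨v, Finset.mem_univ _, by simp [hg, hv, hv0]⟩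
  have htpos : 0 < t := Finset.sum_pos' (fun u _ => hf0 u) ⟨p, Finset.mem_univ _, by simp [hf, hp, hp0]⟩
  set x : V → ℝ := fun u => s * f u - t * g u with hx
  have hxB : ∀ u ∈ B, x u = - (t * max (-φ u) 0) := by intro u hu; simp [hx, hf, hg, hu]
  have hxA : ∀ u, u ∉ B → x u = s * max (-φ u) 0 := by intro u hu; simp [hx, hf, hg, hu]
  have hsum : ∑ u, x u = 0 := by
    simp only [hx, Finset.sum_sub_distrib, ← Finset.mul_sum]
    rw [← hs, ← ht]; ring
  have hR := aux_rayleigh G hG l hl x hsum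
  have hφu : ∀ u, ∑ w ∈ G.neighborFinset u, (φ u - φ w) = l * φ u := by
    intro u
    rw [← aux_lap_apply, hφ]; rfl
  have hAterm : ∀ u w, u ∉ B → φ u < 0 → G.Adj u w → x u - x w ≤ s * (φ w - φ u) := by
    intro u w hu hu0 huw
    have hw : w ∉ B := fun hw => absurd (hcross w u huw.symm hw hu).2 (by linarith)
    rw [hxA u hu, hxA w hw, max_eq_left (by linarith : (0:ℝ) ≤ -φ u)]
    nlinarith [le_max_left (-φ w) 0]
  have hle : ∀ u, x u * (G.lapMatrix ℝ *ᵥ x) u ≤ l * x u ^ 2 := by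
    intro u
    rw [aux_lap_apply]
    by_cases hu0 : φ u < 0
    · by_cases hu : u ∈ B
      · have hxu : x u = t * φ u := by
          rw [hxB u hu, max_eq_left (by linarith : (0:ℝ) ≤ -φ u)]; ring
        have h1 : ∑ w ∈ G.neighborFinset u, t * (φ u - φ w)
            ≤ ∑ w ∈ G.neighborFinset u, (x u - x w) := by
          refine Finset.sum_le_sum fun w hw => ?_
          rw [SimpleGraph.mem_neighborFinset] at hw
          have hwB : w ∈ B := by
            by_contra hwB
            exact absurd (hcross u w hw hu hwB).1 (by linarith)
          rw [hxu, hxB w hwB]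
          nlinarith [le_max_left (-φ w) 0]
        rw [← Finset.mul_sum, hφu] at h1
        have : x u ≤ 0 := by rw [hxu]; nlinarith
        have h2 : l * x u ≤ ∑ w ∈ G.neighborFinset u, (x u - x w) := by
          rw [show l * x u = t * (l * φ u) by rw [hxu]; ring]; exact h1
        nlinarith
      · have hxu : x u = s * (-φ u) := by
          rw [hxA u hu, max_eq_left (by linarith : (0:ℝ) ≤ -φ u)]
        have h1 : ∑ w ∈ G.neighborFinset u, (x u - x w) ≤
            ∑ w ∈ G.neighborFinset u, (-s) * (φ u - φ w) := by
          refine Finset.sum_le_sum fun w hw => ?_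
          rw [SimpleGraph.mem_neighborFinset] at hw
          linarith [hAterm u w hu hu0 hw]
        rw [← Finset.mul_sum, hφu] at h1
        have : 0 ≤ x u := by rw [hxu]; nlinarith
        have h2 : ∑ w ∈ G.neighborFinset u, (x u - x w) ≤ l * x u := by
          rw [show l * x u = -s * (l * φ u) by rw [hxu]; ring]; exact h1
        nlinarith
    · have : x u = 0 := by
        have hm : max (-φ u) 0 = 0 := max_eq_right (by linarith)
        by_cases hu : u ∈ B
        · rw [hxB u hu, hm]; simp
        · rw [hxA u hu, hm]; simp
      rw [this]; simp
  have hlt : x p * (G.lapMatrix ℝ *ᵥ x) p < l * x p ^ 2 := by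
    rw [aux_lap_apply]
    have hxu : x p = s * (-φ p) := by
      rw [hxA p hp, max_eq_left (by linarith : (0:ℝ) ≤ -φ p)]
    have h1 : ∑ w ∈ G.neighborFinset p, (x p - x w) <
        ∑ w ∈ G.neighborFinset p, (-s) * (φ p - φ w) := by
      refine Finset.sum_lt_sum (fun w hw => ?_) ⟨q, by simpa using hpq, ?_⟩
      · rw [SimpleGraph.mem_neighborFinset] at hw
        linarith [hAterm p w hp hp0 hw]
      · have hq : q ∉ B := fun hq => absurd (hcross q p hpq.symm hq hp).2 (by linarith)
        rw [hxu, hxA q hq, max_eq_right (by linarith)]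
        nlinarith
    rw [← Finset.mul_sum, hφu] at h1
    have : 0 < x p := by rw [hxu]; nlinarith
    have h2 : ∑ w ∈ G.neighborFinset p, (x p - x w) < l * x p := by
      rw [show l * x p = -s * (l * φ p) by rw [hxu]; ring]; exact h1
    nlinarith
  have := Finset.sum_lt_sum (fun u (_ : u ∈ Finset.univ) => hle u) ⟨p, Finset.mem_univ _, hlt⟩
  rw [← Finset.mul_sum] at this
  linarith

lemma aux_flux {V : Type*} [Fintype V] [DecidableEq V]
    (G : SimpleGraph V) [DecidableRel G.Adj] (φ : V → ℝ) (B : Finset V) (a b : V)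
    (hab : G.Adj b a) (ha : a ∉ B) (hb : b ∈ B)
    (hcross : ∀ u w, G.Adj u w → u ∈ B → w ∉ B → u = b ∧ w = a) :
    ∑ u ∈ B, (G.lapMatrix ℝ *ᵥ φ) u = φ b - φ a := by
  set F : V → V → ℝ := fun u w => if G.Adj u w then φ u - φ w else 0 with hF
  have h1 : ∀ u, (G.lapMatrix ℝ *ᵥ φ) u = ∑ w ∈ B, F u w + ∑ w ∈ Bᶜ, F u w := by
    intro u
    rw [aux_lap_apply, Finset.sum_add_sum_compl, SimpleGraph.neighborFinset_eq_filter,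
      Finset.sum_filter]
  simp only [h1, Finset.sum_add_distrib]
  have h2 : ∑ u ∈ B, ∑ w ∈ B, F u w = 0 := by
    have h3 : ∑ u ∈ B, ∑ w ∈ B, F u w = - ∑ u ∈ B, ∑ w ∈ B, F u w := by
      conv_lhs => rw [Finset.sum_comm]
      rw [← Finset.sum_neg_distrib]
      refine Finset.sum_congr rfl fun u _ => ?_
      rw [← Finset.sum_neg_distrib]
      refine Finset.sum_congr rfl fun w _ => ?_
      simp only [hF, G.adj_comm w u]
      split_ifs <;> ring
    linarith
  rw [h2, zero_add, Finset.sum_eq_single_of_mem b hb, Finset.sum_eq_single_of_mem a (by simpa using ha)]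
  · simp [hF, hab]
  · intro w hw hwa
    simp only [hF]
    rw [if_neg]
    intro h
    exact hwa (hcross b w h hb (by simpa using hw)).2
  · intro u hu hub
    refine Finset.sum_eq_zero fun w hw => ?_
    simp only [hF]
    rw [if_neg]
    intro h
    exact hub (hcross u w h hu (by simpa using hw)).1

/-- Monotonicity of the Fiedler vector along a path in a tree: if `p 0, p 1, …, p m` is a
path (distinct, consecutively adjacent vertices) with `φ (p 0) < 0` and `φ (p i) > 0` for
`1 ≤ i ≤ m`, then `φ` is strictly increasing along `p 1, …, p m`. -/
theorem fiedler_strictMono_along_path {V : Type*} [Fintype V] [DecidableEq V]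
    (G : SimpleGraph V) [DecidableRel G.Adj] (hT : G.IsTree) (hcard : 2 ≤ Fintype.card V)
    (l : ℝ) (hl : G.IsSecondLapEigenvalue l) (φ : V → ℝ) (hpair : G.IsLapEigenpair l φ)
    (m : ℕ) (hm : 2 ≤ m) (p : Fin (m + 1) → V) (hinj : Function.Injective p)
    (hadj : ∀ i : Fin m, G.Adj (p i.castSucc) (p i.succ))
    (hneg : φ (p 0) < 0) (hpos : ∀ i : Fin (m + 1), i ≠ 0 → 0 < φ (p i)) :
    ∀ i j : Fin (m + 1), 1 ≤ (i : ℕ) → i < j → φ (p i) < φ (p j) := by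
  have hstep : ∀ i : Fin m, 1 ≤ (i : ℕ) → φ (p i.castSucc) < φ (p i.succ) := by
    classical
    intro i hi
    set a := p i.castSucc with ha
    set b := p i.succ with hb
    have hab : G.Adj a b := hadj i
    set G' := G.deleteEdges {s(a, b)} with hG'
    have hbr : ¬ G'.Reachable a b := by
      have := SimpleGraph.isAcyclic_iff_forall_adj_isBridge.mp hT.2 hab
      rw [SimpleGraph.isBridge_iff] at this
      exact this
    set B : Finset V := Finset.univ.filter (fun v => G'.Reachable v b) with hB
    have hmem : ∀ v, v ∈ B ↔ G'.Reachable v b := by intro v; simp [hB]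
    have haB : a ∉ B := by rw [hmem]; exact hbr
    have hbB : b ∈ B := by rw [hmem]
    have hcross : ∀ u w, G.Adj u w → u ∈ B → w ∉ B → u = b ∧ w = a := by
      intro u w huw hu hw
      by_cases he : s(u, w) = s(a, b)
      · rw [Sym2.eq_iff] at he
        rcases he with ⟨h1, h2⟩ | ⟨h1, h2⟩
        · exact absurd (h1 ▸ hu) haB
        · exact ⟨h1, h2⟩
      · exfalso
        have h' : G'.Adj u w := by
          rw [hG', SimpleGraph.deleteEdges_adj]
          exact ⟨huw, by simpa using he⟩
        rw [hmem] at hu hw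
        exact hw (h'.symm.reachable.trans hu)
    have hreach : ∀ k : ℕ, ∀ hk : k ≤ (i : ℕ),
        G'.Reachable (p 0) (p ⟨k, by omega⟩) := by
      intro k
      induction k with
      | zero => intro _; exact SimpleGraph.Reachable.refl _
      | succ k ih =>
        intro hk
        refine (ih (by omega)).trans (SimpleGraph.Adj.reachable ?_)
        rw [hG', SimpleGraph.deleteEdges_adj]
        refine ⟨hadj ⟨k, by omega⟩, ?_⟩
        rw [Set.mem_singleton_iff, Sym2.eq_iff]
        rintro (⟨h1, -⟩ | ⟨h1, -⟩)
        · have := congrArg Fin.val (hinj h1)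
          simp at this; omega
        · have := congrArg Fin.val (hinj h1)
          simp at this; omega
    have hp0B : p 0 ∉ B := by
      rw [hmem]
      intro h
      exact hbr ((hreach i le_rfl).symm.trans h)
    have hapos : 0 < φ a := hpos _ (by intro h; have := congrArg Fin.val h; simp at this; omega)
    have hbpos : 0 < φ b := hpos _ (Fin.succ_ne_zero _)
    have hadj0 : G.Adj (p 0) (p ⟨1, by omega⟩) := hadj ⟨0, by omega⟩
    have hp1 : 0 < φ (p ⟨1, by omega⟩) := hpos _ (by intro h; have := congrArg Fin.val h; simp at this)
    have hnn := aux_nonneg G hT.1 l hl φ hpair.2 B (by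
      intro u w huw hu hw
      obtain ⟨rfl, rfl⟩ := hcross u w huw hu hw
      exact ⟨hbpos, hapos⟩) (p 0) _ hp0B hadj0 hneg hp1
    have hfl := aux_flux G φ B a b hab.symm haB hbB hcross
    rw [hpair.2] at hfl
    simp only [Pi.smul_apply, smul_eq_mul, ← Finset.mul_sum] at hfl
    have hS : 0 < ∑ u ∈ B, φ u := Finset.sum_pos' hnn ⟨b, hbB, hbpos⟩
    have := mul_pos hl.2.1 hS
    linarith
  have main : ∀ d : ℕ, ∀ i j : Fin (m + 1), 1 ≤ (i : ℕ) → (j : ℕ) = i + d + 1 →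
      φ (p i) < φ (p j) := by
    intro d
    induction d with
    | zero =>
      intro i j hi hj
      have h := hstep ⟨i, by omega⟩ hi
      have e : (⟨i, by omega⟩ : Fin m).succ = j := Fin.ext (by simp; omega)
      rw [e] at h
      exact h
    | succ d ih =>
      intro i j hi hj
      have h1 := ih i ⟨i + d + 1, by omega⟩ hi rfl
      have h := hstep ⟨i + d + 1, by omega⟩ (by simp)
      have e : (⟨i + d + 1, by omega⟩ : Fin m).succ = j := Fin.ext (by simp; omega)
      rw [e] at h
      exact h1.trans h
  intro i j hi hij
  exact main (j - i - 1) i j hi (by have : (i:ℕ) < j := hij; omega)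
end

section
/- Let G be a finite tree on at least 2 vertices and let φ be an eigenvector of the Laplacian matrix L = D − A with eigenvalue λ₂(G). Then the number of vertices at which φ is strictly positive satisfies |{ v ∈ V : φ(v) > 0 }| ≥ diam(G) / 32, and likewise |{ v ∈ V : φ(v) < 0 }| ≥ diam(G) / 32. -/
open Matrix

namespace FiedlerAux

variable {V : Type*} [Fintype V] [DecidableEq V]

lemma lap_quad (G : SimpleGraph V) [DecidableRel G.Adj] (x : V → ℝ) :
    x ⬝ᵥ (G.lapMatrix ℝ *ᵥ x) =
      (∑ i : V, ∑ j : V, if G.Adj i j then (x i - x j) ^ 2 else 0) / 2 := by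
  rw [← G.lapMatrix_toLinearMap₂' ℝ x, Matrix.toLinearMap₂'_apply']

lemma lap_symm (G : SimpleGraph V) [DecidableRel G.Adj] (x y : V → ℝ) :
    x ⬝ᵥ (G.lapMatrix ℝ *ᵥ y) = (G.lapMatrix ℝ *ᵥ x) ⬝ᵥ y := by
  rw [Matrix.dotProduct_mulVec, ← Matrix.mulVec_transpose, (G.isSymm_lapMatrix (R := ℝ)).eq]

/-- Variational bound for the second eigenvalue. -/
lemma rayleigh (G : SimpleGraph V) [DecidableRel G.Adj] (hc : G.Connected) (l : ℝ)
    (hl : G.IsSecondLapEigenvalue l) (f : V → ℝ) (hf : ∑ v, f v = 0) :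
    l * (f ⬝ᵥ f) ≤ f ⬝ᵥ (G.lapMatrix ℝ *ᵥ f) := by
  have hH : (G.lapMatrix ℝ).IsHermitian := G.isHermitian_lapMatrix (R := ℝ)
  set b := hH.eigenvectorBasis with hb
  have hin : ∀ x y : V → ℝ, x ⬝ᵥ y = inner ℝ (WithLp.toLp 2 x) (WithLp.toLp 2 y) := by
    intro x y
    simp [PiLp.inner_apply, dotProduct, mul_comm]
  have hpars : ∀ x y : V → ℝ, x ⬝ᵥ y = ∑ i, (x ⬝ᵥ ⇑(b i)) * (⇑(b i) ⬝ᵥ y) := by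
    intro x y
    rw [hin, ← b.sum_inner_mul_inner]
    simp [hin]
  have hpos : ∀ i, 0 ≤ hH.eigenvalues i := fun i =>
    (G.posSemidef_lapMatrix ℝ).eigenvalues_nonneg i
  rw [hpars f f, hpars f (G.lapMatrix ℝ *ᵥ f), Finset.mul_sum]
  apply Finset.sum_le_sum
  intro i _
  have he : G.lapMatrix ℝ *ᵥ ⇑(b i) = hH.eigenvalues i • ⇑(b i) := hH.mulVec_eigenvectorBasis i
  rw [lap_symm, he, smul_dotProduct, smul_eq_mul, dotProduct_comm f]
  rcases (hpos i).eq_or_lt with h0 | h0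
  · rw [← h0, zero_smul, SimpleGraph.lapMatrix_mulVec_eq_zero_iff_forall_reachable] at he
    have : ⇑(b i) ⬝ᵥ f = 0 := by
      obtain ⟨v⟩ := hc.nonempty
      have h2 : ∀ w, (b i) w = (b i) v := fun w => he w v (hc.preconnected w v)
      simp only [dotProduct, h2, ← Finset.mul_sum, hf, mul_zero]
    simp [this]
  · have hle := hl.2.2 _ h0 ⟨⇑(b i), by
      intro hz
      have : ‖b i‖ = 1 := b.orthonormal.1 i
      have h3 : b i = 0 := by
        ext v; exact congrFun hz v
      simp [h3] at this, he⟩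
    nlinarith [mul_self_nonneg (⇑(b i) ⬝ᵥ f)]

lemma geod_avoid (G : SimpleGraph V) (hc : G.Connected) {u v x : V} (huv : u ≠ v)
    (h : G.dist x u ≤ G.dist x v) : ∃ p : G.Walk x u, s(u, v) ∉ p.edges := by
  obtain ⟨p, hp, hlen⟩ := hc.exists_path_of_dist x u
  refine ⟨p, fun he => ?_⟩
  have hv : v ∈ p.support := p.snd_mem_support_of_mem_edges he
  have h1 : (p.takeUntil v hv).length < p.length :=
    p.length_takeUntil_lt hv huv.symm
  have h2 := SimpleGraph.dist_le (p.takeUntil v hv)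
  omega

lemma tree_avoid (G : SimpleGraph V) (hT : G.IsTree) {u v : V} (huv : G.Adj u v)
    {x y : V} (p : G.Walk x y) (hp : s(u, v) ∉ p.edges) 
    (h : G.dist x u ≤ G.dist x v) : G.dist y u < G.dist y v := by
  by_contra! h2
  obtain ⟨q, hq⟩ := geod_avoid G hT.1 huv.ne h
  obtain ⟨r, hr⟩ := geod_avoid G hT.1 huv.ne.symm h2
  have hb := SimpleGraph.isAcyclic_iff_forall_adj_isBridge.1 hT.2 huv
  rw [SimpleGraph.isBridge_iff_forall_walk_mem_edges] at hb
  have := hb (q.reverse.append (p.append r))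
  rw [Sym2.eq_swap] at hr
  simp [SimpleGraph.Walk.edges_append, hq, hp, hr] at this

lemma dist_adj_le (G : SimpleGraph V) (hc : G.Connected) {u v : V} (huv : G.Adj u v) (x : V) :
    G.dist x v ≤ G.dist x u + 1 := by
  have := hc.dist_triangle (u := x) (v := u) (w := v)
  rw [SimpleGraph.dist_eq_one_iff_adj.2 huv] at this
  exact this

lemma tree_diff (G : SimpleGraph V) (hT : G.IsTree) {u v : V} (huv : G.Adj u v)
    {x y : V} (p : G.Walk x y) (hp : s(u, v) ∉ p.edges) :
    (G.dist x u : ℝ) - G.dist y u = G.dist x v - G.dist y v := by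
  have hx1 := dist_adj_le G hT.1 huv x
  have hx2 := dist_adj_le G hT.1 huv.symm x
  have hy1 := dist_adj_le G hT.1 huv y
  have hy2 := dist_adj_le G hT.1 huv.symm y
  have hp' : s(v, u) ∉ p.edges := by rwa [Sym2.eq_swap]
  have a1 := tree_avoid G hT huv p hp
  have a2 := tree_avoid G hT huv.symm p hp'
  have a3 := tree_avoid G hT huv p.reverse (by simpa using hp)
  have a4 := tree_avoid G hT huv.symm p.reverse (by simpa using hp')
  have key : G.dist x u + G.dist y v = G.dist x v + G.dist y u := by omega
  have : (G.dist x u : ℝ) + G.dist y v = G.dist x v + G.dist y u := by exact_mod_cast key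
  linarith

lemma abs_diff (G : SimpleGraph V) (hc : G.Connected) {u v : V} (huv : G.Adj u v) (x y : V) :
    (((G.dist x u : ℝ) - G.dist y u) - (G.dist x v - G.dist y v)) ^ 2 ≤ 4 := by
  have hx1 : (G.dist x v : ℝ) ≤ G.dist x u + 1 := by exact_mod_cast dist_adj_le G hc huv x
  have hx2 : (G.dist x u : ℝ) ≤ G.dist x v + 1 := by exact_mod_cast dist_adj_le G hc huv.symm x
  have hy1 : (G.dist y v : ℝ) ≤ G.dist y u + 1 := by exact_mod_cast dist_adj_le G hc huv y
  have hy2 : (G.dist y u : ℝ) ≤ G.dist y v + 1 := by exact_mod_cast dist_adj_le G hc huv.symm y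
  have : (4:ℝ) = 2 ^ 2 := by norm_num
  rw [this]
  apply sq_le_sq' <;> linarith

lemma energy_le (G : SimpleGraph V) [DecidableRel G.Adj] (hT : G.IsTree)
    {x y : V} (p : G.Walk x y) (f : V → ℝ) (hf : ∀ v, f v = (G.dist x v : ℝ) - G.dist y v) :
    (∑ i : V, ∑ j : V, if G.Adj i j then (f i - f j) ^ 2 else 0) ≤ 8 * p.length := by
  rw [← Finset.sum_product' (f := fun i j => if G.Adj i j then (f i - f j) ^ 2 else (0:ℝ))]
  set S : Finset (V × V) := (p.darts.map (fun d => d.toProd)).toFinset ∪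
    (p.darts.map (fun d => d.toProd.swap)).toFinset with hS
  have hcard : S.card ≤ 2 * p.length := by
    refine (Finset.card_union_le _ _).trans ?_
    have h1 := List.toFinset_card_le (p.darts.map (fun d => d.toProd))
    have h2 := List.toFinset_card_le (p.darts.map (fun d => d.toProd.swap))
    simp only [List.length_map, SimpleGraph.Walk.length_darts] at h1 h2
    omega
  have hmem : ∀ i j, s(i, j) ∈ p.edges → (i, j) ∈ S := by
    intro i j h
    rw [SimpleGraph.Walk.edges, List.mem_map] at h
    obtain ⟨d, hd, he⟩ := h
    rw [SimpleGraph.Dart.edge, Sym2.eq_iff] at he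
    rw [hS, Finset.mem_union, List.mem_toFinset, List.mem_toFinset, List.mem_map, List.mem_map]
    rcases he with he | he
    · exact Or.inl ⟨d, hd, Prod.ext he.1 he.2⟩
    · exact Or.inr ⟨d, hd, Prod.ext he.2 he.1⟩
  calc _ ≤ ∑ q ∈ Finset.univ ×ˢ Finset.univ, (if q ∈ S then (4:ℝ) else 0) := by
        apply Finset.sum_le_sum
        rintro ⟨i, j⟩ _
        simp only
        by_cases hA : G.Adj i j
        · rw [if_pos hA]
          by_cases hm : s(i, j) ∈ p.edges
          · rw [if_pos (hmem i j hm), hf, hf]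
            exact abs_diff G hT.1 hA x y
          · rw [hf, hf, tree_diff G hT hA p hm]
            simp only [sub_self]
            split_ifs <;> norm_num
        · rw [if_neg hA]
          split_ifs <;> norm_num
    _ = 4 * S.card := by
        simp [Finset.sum_ite_mem, mul_comm]
    _ ≤ 8 * p.length := by
        have : (S.card : ℝ) ≤ 2 * p.length := by exact_mod_cast hcard
        linarith

lemma sum_sq (D : ℕ) (c : ℝ) :
    ∑ i ∈ Finset.range (D + 1), (2 * (i : ℝ) - c) ^ 2 =
      4 * (D * (D + 1) * (2 * D + 1) / 6) - 4 * c * (D * (D + 1) / 2) + (D + 1) * c ^ 2 := by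
  induction D with
  | zero => simp
  | succ n ih =>
    rw [Finset.sum_range_succ, ih]; push_cast; ring

lemma geod_dist (G : SimpleGraph V) (hc : G.Connected) {x y : V} (p : G.Walk x y)
    (hp : p.length = G.dist x y) (i : ℕ) (hi : i ≤ p.length) :
    (G.dist x (p.getVert i) : ℝ) - G.dist y (p.getVert i) = 2 * i - p.length := by
  have h1 := SimpleGraph.dist_le (p.take i)
  have h2 := SimpleGraph.dist_le (p.drop i)
  rw [SimpleGraph.Walk.take_length] at h1
  rw [SimpleGraph.Walk.drop_length] at h2
  have h3 := hc.dist_triangle (u := x) (v := p.getVert i) (w := y)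
  rw [SimpleGraph.dist_comm (u := y)]
  have e1 : G.dist x (p.getVert i) = i := by omega
  have e2 : G.dist (p.getVert i) y + i = p.length := by omega
  have e3 : (G.dist (p.getVert i) y : ℝ) + i = p.length := by exact_mod_cast e2
  rw [e1]; linarith

lemma upper (G : SimpleGraph V) [DecidableRel G.Adj] (hT : G.IsTree) (l : ℝ)
    (hl : G.IsSecondLapEigenvalue l) : l * (G.diam : ℝ) ^ 2 ≤ 12 := by
  have hc := hT.1
  haveI := hc.nonempty
  obtain ⟨x, y, hxy⟩ := G.exists_dist_eq_diam
  obtain ⟨p, hp, hlen⟩ := hc.exists_path_of_dist x y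
  rcases Nat.eq_zero_or_pos G.diam with h0 | hD
  · rw [h0]; norm_num
  set f : V → ℝ := fun v => (G.dist x v : ℝ) - G.dist y v with hf
  set c : ℝ := (∑ v, f v) / Fintype.card V with hcdef
  have hn : (Fintype.card V : ℝ) ≠ 0 := by
    exact_mod_cast Fintype.card_ne_zero
  have hE := energy_le G hT p f (fun v => rfl)
  have hR := rayleigh G hc l hl (fun v => f v - c) (by
    rw [Finset.sum_sub_distrib]
    simp only [Finset.sum_const, Finset.card_univ, nsmul_eq_mul, hcdef]
    field_simp; simp)
  rw [lap_quad] at hR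
  simp only [sub_sub_sub_cancel_right] at hR
  have hvar : (p.length : ℝ) * (p.length + 1) * (p.length + 2) / 3 ≤
      (fun v => f v - c) ⬝ᵥ (fun v => f v - c) := by
    have hinj : Set.InjOn p.getVert (Finset.range (p.length + 1) : Set ℕ) := by
      refine hp.getVert_injOn.mono ?_
      intro i hi
      simp at hi
      exact hi
    calc _ ≤ ∑ i ∈ Finset.range (p.length + 1), (2 * (i : ℝ) - (p.length + c)) ^ 2 := by
          rw [sum_sq]
          have : 0 ≤ ((p.length : ℝ) + 1) * c ^ 2 := by positivity
          nlinarith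
      _ = ∑ i ∈ Finset.range (p.length + 1), (f (p.getVert i) - c) ^ 2 := by
          apply Finset.sum_congr rfl
          intro i hi
          have := geod_dist G hc p hlen i (by simp at hi; omega)
          simp only [hf]
          rw [this]; ring
      _ = ∑ v ∈ (Finset.range (p.length + 1)).image p.getVert, (f v - c) ^ 2 := by
          rw [Finset.sum_image hinj]
      _ ≤ ∑ v, (f v - c) ^ 2 :=
          Finset.sum_le_sum_of_subset_of_nonneg (Finset.subset_univ _)
            (fun _ _ _ => sq_nonneg _)
      _ = _ := by simp [dotProduct, sq]
  have hpl : (p.length : ℝ) = G.diam := by rw [hlen, hxy]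
  rw [hpl] at hvar hE
  have hDr : (0 : ℝ) < G.diam := by exact_mod_cast hD
  have hlpos := hl.2.1
  have h1 := mul_le_mul_of_nonneg_left hvar hlpos.le
  have h2 : (G.diam : ℝ) * (l * ((G.diam + 1) * (G.diam + 2))) ≤ G.diam * 12 := by nlinarith
  have h3 := le_of_mul_le_mul_left h2 hDr
  nlinarith [mul_pos hlpos hDr]

lemma path_energy (G : SimpleGraph V) [DecidableRel G.Adj] {x y : V} (p : G.Walk x y)
    (hp : p.IsPath) (k : ℕ) (hk : k ≤ p.length) (g : V → ℝ) :
    (g x - g (p.getVert k)) ^ 2 ≤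
      k * ∑ i : V, ∑ j : V, if G.Adj i j then (g i - g j) ^ 2 else 0 := by
  have h1 : g x - g (p.getVert k) =
      ∑ i ∈ Finset.range k, (g (p.getVert i) - g (p.getVert (i + 1))) := by
    rw [Finset.sum_range_sub' (fun i => g (p.getVert i))]; simp
  have h2 := sq_sum_le_card_mul_sum_sq (s := Finset.range k)
    (f := fun i => g (p.getVert i) - g (p.getVert (i + 1)))
  rw [h1]
  refine h2.trans ?_
  rw [Finset.card_range]
  gcongr
  have hinj : Set.InjOn (fun i => (p.getVert i, p.getVert (i + 1)))
      (Finset.range k : Set ℕ) := by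
    intro i hi j hj hij
    simp only [Finset.coe_range, Set.mem_Iio] at hi hj
    exact hp.getVert_injOn (show i ≤ p.length by omega) (show j ≤ p.length by omega)
      (congrArg Prod.fst hij)
  rw [← Finset.sum_product' (f := fun i j => if G.Adj i j then (g i - g j) ^ 2 else (0:ℝ))]
  calc _ = ∑ i ∈ Finset.range k, (fun q : V × V => if G.Adj q.1 q.2 then (g q.1 - g q.2) ^ 2
            else (0:ℝ)) (p.getVert i, p.getVert (i + 1)) := by
        apply Finset.sum_congr rfl
        intro i hi
        have := p.adj_getVert_succ (i := i) (by simp at hi; omega)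
        simp [this]
    _ = ∑ q ∈ (Finset.range k).image (fun i => (p.getVert i, p.getVert (i + 1))),
          if G.Adj q.1 q.2 then (g q.1 - g q.2) ^ 2 else (0:ℝ) := by
        rw [Finset.sum_image hinj]
    _ ≤ _ := by
        apply Finset.sum_le_sum_of_subset_of_nonneg
        · intro q _; simp
        · intro q _ _
          split_ifs <;> positivity

lemma lower (G : SimpleGraph V) [DecidableRel G.Adj] (hc : G.Connected) (l : ℝ) (hl : 0 < l)
    (φ : V → ℝ) (hpair : G.IsLapEigenpair l φ) :
    1 ≤ 2 * l * ((Finset.univ.filter fun v : V => 0 < φ v).card : ℝ) ^ 2 := by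
  obtain ⟨hne, heig⟩ := hpair
  have hsum : ∑ v, φ v = 0 := by
    have h1 := lap_symm G (fun _ => 1) φ
    rw [G.lapMatrix_mulVec_const_eq_zero, heig] at h1
    simp [dotProduct, ← Finset.mul_sum, hl.ne'] at h1
    exact h1
  haveI := hc.nonempty
  obtain ⟨v, hv⟩ := Finite.exists_max φ
  obtain ⟨w, hw⟩ := Finite.exists_min φ
  have hvpos : 0 < φ v := by
    by_contra! h
    apply hne
    have := (Finset.sum_eq_zero_iff_of_nonpos (fun i _ => (hv i).trans h)).1 hsum
    funext i; exact this i (Finset.mem_univ i)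
  have hwneg : φ w ≤ 0 := by
    by_contra! h
    have : 0 < ∑ v, φ v := Finset.sum_pos (fun i _ => h.trans_le (hw i)) Finset.univ_nonempty
    linarith
  obtain ⟨p, hp, -⟩ := hc.exists_path_of_dist v w
  have hex : ∃ k, φ (p.getVert k) ≤ 0 := ⟨p.length, by simpa using hwneg⟩
  classical
  set k := Nat.find hex with hk
  have hk0 : φ (p.getVert k) ≤ 0 := Nat.find_spec hex
  have hklen : k ≤ p.length := Nat.find_min' hex (by simpa using hwneg)
  set P := Finset.univ.filter fun v : V => 0 < φ v with hP
  have hkP : k ≤ P.card := by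
    have : (Finset.range k).card ≤ P.card := by
      apply Finset.card_le_card_of_injOn p.getVert
      · intro i hi
        have hi' : i < k := by simpa using hi
        have := Nat.find_min hex hi'
        simp [hP]
        exact not_le.1 this
      · intro i hi j hj hij
        simp only [Finset.coe_range, Set.mem_Iio] at hi hj
        exact hp.getVert_injOn (show i ≤ p.length by omega) (show j ≤ p.length by omega) hij
    simpa using this
  set g : V → ℝ := fun v => max (φ v) 0 with hg
  have hE := path_energy G p hp k hklen g
  have hgv : g v = φ v := max_eq_left hvpos.le
  have hgk : g (p.getVert k) = 0 := max_eq_right hk0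
  rw [hgv, hgk, sub_zero] at hE
  have hq := lap_quad G g
  have hle : g ⬝ᵥ (G.lapMatrix ℝ *ᵥ g) ≤ l * ∑ v, g v ^ 2 := by
    rw [Finset.mul_sum]
    apply Finset.sum_le_sum
    intro i _
    rcases le_or_gt (φ i) 0 with h | h
    · have : g i = 0 := max_eq_right h
      simp [this]
    · have hi : g i = φ i := max_eq_left h.le
      have h1 : (G.lapMatrix ℝ *ᵥ g) i ≤ (G.lapMatrix ℝ *ᵥ φ) i := by
        rw [G.lapMatrix_mulVec_apply, G.lapMatrix_mulVec_apply, hi]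
        have : ∑ u ∈ G.neighborFinset i, φ u ≤ ∑ u ∈ G.neighborFinset i, g u :=
          Finset.sum_le_sum (fun u _ => le_max_left _ _)
        linarith
      rw [heig] at h1
      simp only [Pi.smul_apply, smul_eq_mul] at h1
      rw [hi]
      nlinarith
  have hsq : ∑ v, g v ^ 2 ≤ P.card * φ v ^ 2 := by
    calc _ ≤ ∑ u, if 0 < φ u then φ v ^ 2 else 0 := by
          apply Finset.sum_le_sum
          intro u _
          split_ifs with h
          · have : g u = φ u := max_eq_left h.le
            rw [this]
            exact pow_le_pow_left₀ h.le (hv u) 2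
          · have : g u = 0 := max_eq_right (not_lt.1 h)
            simp [this]
      _ = _ := by
          rw [← Finset.sum_filter]; simp [hP]
  set E := ∑ i : V, ∑ j : V, if G.Adj i j then (g i - g j) ^ 2 else 0 with hEdef
  have hE0 : 0 ≤ E := by rw [hEdef]; positivity
  have hkr : (k : ℝ) ≤ P.card := by exact_mod_cast hkP
  have hE2 : E ≤ 2 * (l * (P.card * φ v ^ 2)) := by
    have := mul_le_mul_of_nonneg_left hsq hl.le
    linarith
  have hfin : φ v ^ 2 * 1 ≤ φ v ^ 2 * (2 * l * (P.card : ℝ) ^ 2) := by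
    calc φ v ^ 2 * 1 ≤ k * E := by linarith
      _ ≤ P.card * E := mul_le_mul_of_nonneg_right hkr hE0
      _ ≤ P.card * (2 * (l * (P.card * φ v ^ 2))) :=
          mul_le_mul_of_nonneg_left hE2 (Nat.cast_nonneg _)
      _ = _ := by ring
  exact le_of_mul_le_mul_left hfin (by positivity)

lemma main (G : SimpleGraph V) [DecidableRel G.Adj] (hT : G.IsTree) (l : ℝ)
    (hl : G.IsSecondLapEigenvalue l) (φ : V → ℝ) (hpair : G.IsLapEigenpair l φ) :
    (G.diam : ℝ) / 32 ≤ ((Finset.univ.filter fun v : V => 0 < φ v).card : ℝ) := by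
  have h1 := upper G hT l hl
  have h2 := lower G hT.1 l hl.2.1 φ hpair
  set P : ℝ := ((Finset.univ.filter fun v : V => 0 < φ v).card : ℝ) with hP
  have hP0 : 0 ≤ P := Nat.cast_nonneg _
  have hl0 := hl.2.1
  have h3 : l * (G.diam : ℝ) ^ 2 ≤ l * (24 * P ^ 2) := by linarith
  have h4 := le_of_mul_le_mul_left h3 hl0
  have h5 : (G.diam : ℝ) ≤ 32 * P := by
    apply le_of_sq_le_sq _ (by positivity)
    nlinarith [sq_nonneg P]
  linarith

end FiedlerAux

/-- For a finite tree on at least two vertices, a Fiedler vector is strictly positive on at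
least `diam(G)/32` vertices and strictly negative on at least `diam(G)/32` vertices. -/
theorem card_pos_fiedler_ge_diam_div_32 {V : Type*} [Fintype V] [DecidableEq V]
    (G : SimpleGraph V) [DecidableRel G.Adj] (hT : G.IsTree) (hcard : 2 ≤ Fintype.card V)
    (l : ℝ) (hl : G.IsSecondLapEigenvalue l) (φ : V → ℝ)
    (hpair : G.IsLapEigenpair l φ) :
    (G.diam : ℝ) / 32 ≤ ((Finset.univ.filter fun v : V => 0 < φ v).card : ℝ) ∧
      (G.diam : ℝ) / 32 ≤ ((Finset.univ.filter fun v : V => φ v < 0).card : ℝ) := by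

  refine ⟨FiedlerAux.main G hT l hl φ hpair, ?_⟩
  have h := FiedlerAux.main G hT l hl (-φ) ⟨neg_ne_zero.2 hpair.1, by
    rw [Matrix.mulVec_neg, hpair.2, smul_neg]⟩
  simpa using h
end
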